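/- Suppose the pair (A, C) is observable, C has full row rank q, S* and W are symmetric positive definite, 𝓛 ⊆ ℝ^{n×q} satisfies the uniform stability condition, and the true gain L* lies in the interior of 𝓛 (so in particular ρ(A − L*C) < 1). Then the unique stationary point of V̄ on the closure of 𝓛 is L*: for every L in the closure of 𝓛, the Fréchet derivative of V̄ at L vanishes if and only if L = L*. -/

import Mathlib

open Matrix MeasureTheory Filter Topology

attribute [local instance] Matrix.frobeniusNormedAddCommGroup Matrix.frobeniusNormedSpace

/-- Operator norm induced by the Euclidean norm. -/
noncomputable def opNorm {a b : ℕ} (M : Matrix (Fin a) (Fin b) ℝ) : ℝ :=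
  ‖LinearMap.toContinuousLinearMap (Matrix.toEuclideanLin M)‖

/-- Steady-state error covariance `Σ̄(L)`, the solution of the Lyapunov equation
`Σ̄(L) = (A − LC) Σ̄(L) (A − LC)ᵀ + (L − L*) S* (L − L*)ᵀ`. -/
noncomputable def Sigmabar {n q : ℕ} (A : Matrix (Fin n) (Fin n) ℝ)
    (C : Matrix (Fin q) (Fin n) ℝ) (Lstar : Matrix (Fin n) (Fin q) ℝ)
    (Sstar : Matrix (Fin q) (Fin q) ℝ) (L : Matrix (Fin n) (Fin q) ℝ) :
    Matrix (Fin n) (Fin n) ℝ :=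
  ∑' i : ℕ, (A - L * C) ^ i * ((L - Lstar) * Sstar * (L - Lstar)ᵀ) * ((A - L * C)ᵀ) ^ i

/-- Asymptotic objective `V̄(L) = Tr(W (S* + C Σ̄(L) Cᵀ))`. -/
noncomputable def Vbar {n q : ℕ} (A : Matrix (Fin n) (Fin n) ℝ)
    (C : Matrix (Fin q) (Fin n) ℝ) (Lstar : Matrix (Fin n) (Fin q) ℝ)
    (Sstar W : Matrix (Fin q) (Fin q) ℝ) (L : Matrix (Fin n) (Fin q) ℝ) : ℝ :=
  (W * (Sstar + C * Sigmabar A C Lstar Sstar L * Cᵀ)).trace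

/-- If some power of `a` has norm less than one, the geometric series of `a` converges. -/
theorem aux_summable_pow {R : Type*} [NormedRing R] [CompleteSpace R] (a : R) (k : ℕ)
    (hk : k ≠ 0) (h : ‖a ^ k‖ < 1) : Summable (fun i : ℕ => a ^ i) := by
  have : NeZero k := ⟨hk⟩
  rw [← (Nat.divModEquiv k).symm.summable_iff]
  have h1 : Summable (fun j : ℕ => ‖(a ^ k) ^ j‖) :=
    (summable_geometric_of_lt_one (norm_nonneg _) h).of_norm_bounded_eventually_nat (by
      filter_upwards [eventually_gt_atTop 0] with j hj
      simpa using norm_pow_le' (a ^ k) hj)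
  have h2 : Summable (fun r : Fin k => ‖a ^ (r : ℕ)‖) := Summable.of_finite
  have h3 := h1.mul_of_nonneg h2 (fun _ => norm_nonneg _) (fun _ => norm_nonneg _)
  refine Summable.of_norm_bounded h3 ?_
  rintro ⟨j, r⟩
  have : ((fun i : ℕ => a ^ i) ∘ ⇑(Nat.divModEquiv k).symm) (j, r) = (a ^ k) ^ j * a ^ (r : ℕ) := by
    simp [Nat.divModEquiv, ← pow_mul, pow_add, mul_comm]
  rw [this]
  exact norm_mul_le _ _

open scoped MatrixOrder in
/-- Factorization of a positive semidefinite matrix. -/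
theorem aux_factor {n : ℕ} (X : Matrix (Fin n) (Fin n) ℝ) (hX : X.PosSemidef) :
    ∃ B : Matrix (Fin n) (Fin n) ℝ, X = Bᵀ * B := by
  obtain ⟨B, hB⟩ := CStarAlgebra.nonneg_iff_eq_star_mul_self.mp hX.nonneg
  exact ⟨B, by rw [hB, star_eq_conjTranspose, conjTranspose_eq_transpose_of_trivial]⟩

/-- Abstract regularity statement for solutions of Lyapunov type equations. -/
theorem aux_abstract {U V M : Type*} [NormedAddCommGroup U] [NormedSpace ℝ U]
    [FiniteDimensional ℝ U] [NormedAddCommGroup V] [NormedSpace ℝ V] [FiniteDimensional ℝ V]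
    [NormedAddCommGroup M] [NormedSpace ℝ M] [FiniteDimensional ℝ M]
    (l r : U →ₗ[ℝ] M →ₗ[ℝ] M) (m : V →ₗ[ℝ] U) (a : U) (b : V →ₗ[ℝ] V →ₗ[ℝ] M) (v₀ v : V)
    (u : ℕ → U) (hu : Tendsto u atTop (𝓝 0))
    (hT : ∀ i X, (l (a - m v) ∘ₗ r (a - m v))^[i] X = l (u i) (r (u i) X))
    (σ : V → M)
    (hσ : ∀ w, σ w = ∑' i : ℕ, (l (a - m w) ∘ₗ r (a - m w))^[i] (b (w - v₀) (w - v₀))) :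
    (∀ᶠ w in 𝓝 v, σ w = l (a - m w) (r (a - m w) (σ w)) + b (w - v₀) (w - v₀)) ∧
      DifferentiableAt ℝ σ v := by
  have : CompleteSpace M := FiniteDimensional.complete ℝ M
  let tc : (M →ₗ[ℝ] M) →ₗ[ℝ] (M →L[ℝ] M) :=
    (LinearMap.toContinuousLinearMap (𝕜 := ℝ) (E := M) (F' := M)).toLinearMap
  let l' : U →L[ℝ] M →L[ℝ] M := LinearMap.toContinuousLinearMap (tc ∘ₗ l)
  let r' : U →L[ℝ] M →L[ℝ] M := LinearMap.toContinuousLinearMap (tc ∘ₗ r)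
  let T : U → (M →L[ℝ] M) := fun F => l' F * r' F
  have hTd : Differentiable ℝ T := l'.differentiable.mul r'.differentiable
  have hTa : ∀ F X, T F X = l F (r F X) := fun F X => rfl
  have hTp : ∀ F i X, (T F ^ i) X = (l F ∘ₗ r F)^[i] X := by
    intro F i X
    induction i generalizing X with
    | zero => rfl
    | succ k ih => rw [pow_succ, Function.iterate_succ_apply, ← ih]; rfl
  have hlim : Tendsto (fun i : ℕ => T (a - m v) ^ i) atTop (𝓝 0) := by
    have h1 : ∀ i : ℕ, T (a - m v) ^ i = T (u i) := fun i => by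
      ext1 X; rw [hTp, hT, hTa]
    simp_rw [h1]
    have h0 : T 0 = 0 := by simp [T]
    have h2 := hTd.continuous.tendsto 0
    rw [h0] at h2
    exact h2.comp hu
  have hF : Differentiable ℝ (fun w : V => a - m w) :=
    (LinearMap.toContinuousLinearMap m).differentiable.const_sub a
  have h1 : ∀ᶠ i : ℕ in atTop, ‖T (a - m v) ^ i‖ < 1 := by
    have := hlim.norm
    rw [norm_zero] at this
    exact this.eventually_lt_const one_pos
  obtain ⟨k, hk, hk0⟩ := (h1.and (eventually_gt_atTop 0)).exists
  have hev : ∀ᶠ w in 𝓝 v, Summable (fun i : ℕ => T (a - m w) ^ i) := by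
    have hc : Continuous (fun w => ‖T (a - m w) ^ k‖) :=
      ((hTd.continuous.comp hF.continuous).pow k).norm
    filter_upwards [hc.continuousAt.eventually_lt_const hk] with G hG
    exact aux_summable_pow _ k hk0.ne' hG
  have key : ∀ w, Summable (fun i : ℕ => T (a - m w) ^ i) → 
      IsUnit (1 - T (a - m w)) ∧ 
      σ w = Ring.inverse (1 - T (a - m w)) (b (w - v₀) (w - v₀)) := by
    intro w h
    let U' : (M →L[ℝ] M)ˣ := ⟨1 - T (a - m w), ∑' i : ℕ, T (a - m w) ^ i,
      h.one_sub_mul_tsum_pow, h.tsum_pow_mul_one_sub⟩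
    have hu : (1 - T (a - m w)) = (U' : M →L[ℝ] M) := rfl
    refine ⟨U'.isUnit, ?_⟩
    rw [hu, Ring.inverse_unit]
    change _ = (∑' i : ℕ, T (a - m w) ^ i) _
    rw [hσ]
    simp_rw [← hTp]
    exact ((ContinuousLinearMap.apply ℝ M (b (w - v₀) (w - v₀))).map_tsum h).symm
  constructor
  · filter_upwards [hev] with w hw
    obtain ⟨h2, h1⟩ := key w hw
    have h3 := congrArg (fun f => f (b (w - v₀) (w - v₀))) (Ring.mul_inverse_cancel _ h2)
    have h4 : (1 - T (a - m w)) (σ w) = b (w - v₀) (w - v₀) := by rw [h1]; exact h3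
    have h5 : σ w - l (a - m w) (r (a - m w) (σ w)) = b (w - v₀) (w - v₀) := h4
    rw [← h5]; abel
  · have heq : σ =ᶠ[𝓝 v] fun w => Ring.inverse (1 - T (a - m w)) (b (w - v₀) (w - v₀)) := by
      filter_upwards [hev] with w hw
      exact (key w hw).2
    refine DifferentiableAt.congr_of_eventuallyEq ?_ heq
    have h1 : DifferentiableAt ℝ (fun w => Ring.inverse (1 - T (a - m w))) v :=
      DifferentiableAt.comp (f := fun w => 1 - T (a - m w)) v
        (differentiableAt_inverse (key v hev.self_of_nhds).1)
        ((hTd.comp hF).differentiableAt.const_sub 1)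
    refine h1.clm_apply ?_
    let b' : V →L[ℝ] V →L[ℝ] M := LinearMap.toContinuousLinearMap
      ((LinearMap.toContinuousLinearMap (𝕜 := ℝ) (E := V) (F' := M)).toLinearMap ∘ₗ b)
    have hD : Differentiable ℝ (fun w : V => w - v₀) := differentiable_id.sub_const v₀
    exact ((b'.differentiable.comp hD).clm_apply hD) v

/-- Derivative along a line of a solution of a Lyapunov type equation. -/
theorem aux_line {M : Type*} [NormedAddCommGroup M] [NormedSpace ℝ M] [FiniteDimensional ℝ M]
    (T T₁ T₂ : M →ₗ[ℝ] M) (c c₁ c₂ : M) (g : ℝ → M) (G : M) (hg : HasDerivAt g G 0)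
    (h : ∀ᶠ t in 𝓝 (0 : ℝ), g t = (T (g t) + t • T₁ (g t) + (t * t) • T₂ (g t))
      + (c + t • c₁ + (t * t) • c₂)) :
    G = T G + (T₁ (g 0) + c₁) := by
  have hl : ∀ S : M →ₗ[ℝ] M, HasDerivAt (fun t => S (g t)) (S G) 0 := fun S =>
    (LinearMap.toContinuousLinearMap S).hasFDerivAt.comp_hasDerivAt 0 hg
  have hi : HasDerivAt (fun t : ℝ => t) 1 0 := hasDerivAt_id 0
  have h1 := (((hl T).add (hi.smul (hl T₁))).add ((hi.mul hi).smul (hl T₂))).add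
    (((hasDerivAt_const (0 : ℝ) c).add (hi.smul (hasDerivAt_const (0 : ℝ) c₁))).add
      ((hi.mul hi).smul (hasDerivAt_const (0 : ℝ) c₂)))
  have h2 := hg.unique (h1.congr_of_eventuallyEq h)
  simpa [add_assoc] using h2

theorem aux_pow_tendsto {n : ℕ} (F : Matrix (Fin n) (Fin n) ℝ) (γ lam : ℝ)
    (hlam : lam ∈ Set.Ioo (0 : ℝ) 1) (h : ∀ i : ℕ, opNorm (F ^ i) ≤ γ * lam ^ i) :
    Tendsto (fun i : ℕ => F ^ i) atTop (𝓝 0) := by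
  let e := (Matrix.toEuclideanLin (𝕜 := ℝ) (m := Fin n) (n := Fin n)).trans
    LinearMap.toContinuousLinearMap
  have h0 : Tendsto (fun i : ℕ => e (F ^ i)) atTop (𝓝 0) := by
    refine squeeze_zero_norm h ?_
    simpa using (tendsto_pow_atTop_nhds_zero_of_lt_one hlam.1.le hlam.2).const_mul γ
  have hc : Continuous e.symm := LinearMap.continuous_of_finiteDimensional e.symm.toLinearMap
  have h1 := (hc.tendsto 0).comp h0
  rw [map_zero] at h1
  refine h1.congr fun i => ?_
  exact e.symm_apply_apply _

theorem aux_opNorm_continuous {a b : ℕ} : Continuous (opNorm (a := a) (b := b)) := by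
  let e := (Matrix.toEuclideanLin (𝕜 := ℝ) (m := Fin a) (n := Fin b)).trans
    LinearMap.toContinuousLinearMap
  have hc : Continuous e := LinearMap.continuous_of_finiteDimensional e.toLinearMap
  exact hc.norm

section
variable {n q : ℕ} (A : Matrix (Fin n) (Fin n) ℝ)
    (C : Matrix (Fin q) (Fin n) ℝ) (Lstar : Matrix (Fin n) (Fin q) ℝ)
    (Sstar W : Matrix (Fin q) (Fin q) ℝ) (L : Matrix (Fin n) (Fin q) ℝ)

theorem aux_diff (h : Tendsto (fun i : ℕ => (A - L * C) ^ i) atTop (𝓝 0)) :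
    (∀ᶠ L' in 𝓝 L, Sigmabar A C Lstar Sstar L' =
      (A - L' * C) * (Sigmabar A C Lstar Sstar L' * (A - L' * C)ᵀ)
        + (L' - Lstar) * Sstar * (L' - Lstar)ᵀ) ∧
    DifferentiableAt ℝ (Sigmabar A C Lstar Sstar) L := by
  let m : Matrix (Fin n) (Fin q) ℝ →ₗ[ℝ] Matrix (Fin n) (Fin n) ℝ :=
    { toFun := fun X => X * C, map_add' := fun X Y => Matrix.add_mul _ _ _,
      map_smul' := fun c X => by simp }
  let b : Matrix (Fin n) (Fin q) ℝ →ₗ[ℝ] Matrix (Fin n) (Fin q) ℝ →ₗ[ℝ] Matrix (Fin n) (Fin n) ℝ :=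
    LinearMap.mk₂ ℝ (fun X Y : Matrix (Fin n) (Fin q) ℝ => X * Sstar * Yᵀ)
      (by intros; simp [Matrix.add_mul]) (by intros; simp)
      (by intros; simp [Matrix.mul_add]) (by intros; simp)
  let l : Matrix (Fin n) (Fin n) ℝ →ₗ[ℝ] Matrix (Fin n) (Fin n) ℝ →ₗ[ℝ] Matrix (Fin n) (Fin n) ℝ :=
    LinearMap.mul ℝ (Matrix (Fin n) (Fin n) ℝ)
  let r : Matrix (Fin n) (Fin n) ℝ →ₗ[ℝ] Matrix (Fin n) (Fin n) ℝ →ₗ[ℝ] Matrix (Fin n) (Fin n) ℝ :=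
    (LinearMap.mul ℝ (Matrix (Fin n) (Fin n) ℝ)).flip ∘ₗ
      (Matrix.transposeLinearEquiv (Fin n) (Fin n) ℝ ℝ).toLinearMap
  have hit : ∀ (F X : Matrix (Fin n) (Fin n) ℝ) (i : ℕ),
      (l F ∘ₗ r F)^[i] X = F ^ i * (X * (F ^ i)ᵀ) := by
    intro F X i
    induction i generalizing X with
    | zero => simp
    | succ k ih =>
      rw [Function.iterate_succ_apply, ih]
      simp [l, r, pow_succ, Matrix.mul_assoc]
  refine aux_abstract l r m A b Lstar L (fun i => (A - L * C) ^ i) h ?_ _ ?_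
  · intro i X
    exact hit _ _ _
  · intro w
    unfold Sigmabar
    congr 1; ext1 i
    refine Eq.trans ?_ (hit _ _ _).symm
    rw [transpose_pow, Matrix.mul_assoc]
    rfl

/-- The linear part of the objective. -/
noncomputable def auxPhi : Matrix (Fin n) (Fin n) ℝ →L[ℝ] ℝ :=
  LinearMap.toContinuousLinearMap
    { toFun := fun X => (W * (C * X * Cᵀ)).trace
      map_add' := fun X Y => by simp [Matrix.mul_add, Matrix.add_mul]
      map_smul' := fun c X => by simp }

theorem auxPhi_apply (X : Matrix (Fin n) (Fin n) ℝ) :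
    auxPhi C W X = (W * (C * X * Cᵀ)).trace := rfl

theorem aux_Vbar (L' : Matrix (Fin n) (Fin q) ℝ) : Vbar A C Lstar Sstar W L' =
    (W * Sstar).trace + auxPhi C W (Sigmabar A C Lstar Sstar L') := by
  simp [Vbar, auxPhi_apply, Matrix.mul_add]

theorem auxPhi_nonneg (hW : W.PosDef) (X : Matrix (Fin n) (Fin n) ℝ) (hX : X.PosSemidef) :
    0 ≤ auxPhi C W X := by
  obtain ⟨B, hB⟩ := aux_factor X hX
  rw [auxPhi_apply, hB]
  have h1 := (hW.posSemidef.conjTranspose_mul_mul_same (C * Bᵀ)).trace_nonneg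
  rw [conjTranspose_eq_transpose_of_trivial, Matrix.mul_assoc, Matrix.trace_mul_comm] at h1
  simpa [Matrix.mul_assoc] using h1

theorem auxPhi_zero (hW : W.PosDef) (Y : Matrix (Fin n) (Fin q) ℝ) 
    (h : auxPhi C W (Y * Yᵀ) = 0) : C * Y = 0 := by
  have h1 := hW.posSemidef.conjTranspose_mul_mul_same (C * Y)
  have h2 : ((C * Y)ᴴ * W * (C * Y)).trace = 0 := by
    rw [conjTranspose_eq_transpose_of_trivial, Matrix.mul_assoc, Matrix.trace_mul_comm]
    rw [auxPhi_apply] at h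
    simpa [Matrix.mul_assoc] using h
  have h3 := h1.trace_eq_zero_iff.1 h2
  refine Matrix.ext_of_mulVec_single fun j => ?_
  by_contra hne
  rw [Matrix.zero_mulVec] at hne
  have h4 := hW.dotProduct_mulVec_pos hne
  have h5 : star ((C * Y) *ᵥ Pi.single j 1) ⬝ᵥ W *ᵥ ((C * Y) *ᵥ Pi.single j 1) =
      star (Pi.single j (1 : ℝ)) ⬝ᵥ (((C * Y)ᴴ * W * (C * Y)) *ᵥ Pi.single j 1) := by
    simp only [star_mulVec, dotProduct_mulVec, vecMul_vecMul, Matrix.mul_assoc]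
  rw [h5, h3] at h4
  simp at h4

theorem aux_phi_Sigmabar_nonneg (hS : Sstar.PosDef) (hW : W.PosDef) :
    0 ≤ auxPhi C W (Sigmabar A C Lstar Sstar L) := by
  unfold Sigmabar
  by_cases h : Summable (fun i : ℕ => (A - L * C) ^ i * ((L - Lstar) * Sstar * (L - Lstar)ᵀ) * ((A - L * C)ᵀ) ^ i)
  · rw [(auxPhi C W).map_tsum h]
    refine tsum_nonneg fun i => auxPhi_nonneg C W hW _ ?_
    have h1 := hS.posSemidef.mul_mul_conjTranspose_same (L - Lstar)
    have h2 := h1.mul_mul_conjTranspose_same ((A - L * C) ^ i)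
    simpa [conjTranspose_eq_transpose_of_trivial, transpose_pow] using h2
  · rw [tsum_eq_zero_of_not_summable h]; simp

theorem aux_Sigmabar_symm (hS : Sstarᵀ = Sstar) :
    (Sigmabar A C Lstar Sstar L)ᵀ = Sigmabar A C Lstar Sstar L := by
  unfold Sigmabar
  rw [transpose_tsum]
  congr 1; ext1 i
  simp [transpose_mul, transpose_pow, hS, Matrix.mul_assoc]

theorem aux_obs (hObs : (⋂ i : ℕ, {x : Fin n → ℝ | (C * A ^ i).mulVec x = 0}) = {0})
    (N : Matrix (Fin n) (Fin q) ℝ) (hN : ∀ i : ℕ, C * ((A - L * C) ^ i * N) = 0) : N = 0 := by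
  have h1 : ∀ i : ℕ, A ^ i * N = (A - L * C) ^ i * N := by
    intro i
    induction i with
    | zero => simp
    | succ k ih =>
      rw [pow_succ', pow_succ', Matrix.mul_assoc, ih, Matrix.mul_assoc, Matrix.sub_mul,
        Matrix.mul_assoc L, hN k]
      simp
  refine Matrix.ext_of_mulVec_single fun j => ?_
  have h2 : N *ᵥ Pi.single j 1 ∈ (⋂ i : ℕ, {x : Fin n → ℝ | (C * A ^ i).mulVec x = 0}) := by
    rw [Set.mem_iInter]
    intro i
    change (C * A ^ i) *ᵥ (N *ᵥ Pi.single j 1) = 0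
    rw [mulVec_mulVec, Matrix.mul_assoc, h1, hN, zero_mulVec]
  rw [hObs] at h2
  rw [zero_mulVec]
  exact h2

/-- Stationarity forces the gradient factor to vanish. -/
theorem aux_stationary (hObs : (⋂ i : ℕ, {x : Fin n → ℝ | (C * A ^ i).mulVec x = 0}) = {0})
    (hS : Sstar.PosDef) (hW : W.PosDef)
    (h : Tendsto (fun i : ℕ => (A - L * C) ^ i) atTop (𝓝 0))
    (hd : fderiv ℝ (Vbar A C Lstar Sstar W) L = 0) :
    (L - Lstar) * Sstar = (A - L * C) * Sigmabar A C Lstar Sstar L * Cᵀ := by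
  obtain ⟨hev, hdiff⟩ := aux_diff A C Lstar Sstar L h
  have hSt : Sstarᵀ = Sstar := by
    simpa [Matrix.IsHermitian, conjTranspose_eq_transpose_of_trivial] using hS.isHermitian
  have hsym := aux_Sigmabar_symm A C Lstar Sstar L hSt
  obtain ⟨F, hF⟩ : ∃ F, F = A - L * C := ⟨_, rfl⟩
  obtain ⟨D, hD⟩ : ∃ D, D = L - Lstar := ⟨_, rfl⟩
  obtain ⟨P, hP⟩ : ∃ P, P = Sigmabar A C Lstar Sstar L := ⟨_, rfl⟩
  obtain ⟨N, hN⟩ : ∃ N, N = D * Sstar - F * P * Cᵀ := ⟨_, rfl⟩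
  rw [← hF, ← hD, ← hP]
  rw [← hP] at hsym
  rw [← hF] at h
  suffices hN0 : N = 0 by rw [hN] at hN0; exact sub_eq_zero.1 hN0
  -- the line through `L` in direction `N`
  have hline : HasDerivAt (fun t : ℝ => L + t • N) N 0 := by
    have h1 := ((hasDerivAt_id (0 : ℝ)).smul_const N).const_add L
    rw [one_smul] at h1
    exact h1
  have hL0 : L + (0 : ℝ) • N = L := by simp
  have hg : HasDerivAt (fun t : ℝ => Sigmabar A C Lstar Sstar (L + t • N))
      (fderiv ℝ (Sigmabar A C Lstar Sstar) L N) 0 := by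
    have h1 : HasFDerivAt (Sigmabar A C Lstar Sstar) (fderiv ℝ (Sigmabar A C Lstar Sstar) L)
        (L + (0 : ℝ) • N) := by rw [hL0]; exact hdiff.hasFDerivAt
    exact h1.comp_hasDerivAt (0 : ℝ) hline
  obtain ⟨G, hG⟩ : ∃ G, G = fderiv ℝ (Sigmabar A C Lstar Sstar) L N := ⟨_, rfl⟩
  rw [← hG] at hg
  have hphi : auxPhi C W G = 0 := by
    have h1 : HasFDerivAt (Vbar A C Lstar Sstar W)
        ((auxPhi C W).comp (fderiv ℝ (Sigmabar A C Lstar Sstar) L)) L := by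
      have h2 := ((auxPhi C W).hasFDerivAt.comp L hdiff.hasFDerivAt).const_add (W * Sstar).trace
      refine h2.congr_of_eventuallyEq (Eventually.of_forall fun L' => ?_)
      exact aux_Vbar A C Lstar Sstar W L'
    rw [h1.fderiv] at hd
    rw [hG]
    exact congrArg (fun f => f N) hd
  let mk : Matrix (Fin n) (Fin n) ℝ → Matrix (Fin n) (Fin n) ℝ →
      (Matrix (Fin n) (Fin n) ℝ →ₗ[ℝ] Matrix (Fin n) (Fin n) ℝ) := fun X Y =>
    { toFun := fun Z => X * Z * Y
      map_add' := fun Z Z' => by simp [Matrix.mul_add, Matrix.add_mul]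
      map_smul' := fun c Z => by simp }
  have hmk : ∀ X Y Z, mk X Y Z = X * Z * Y := fun _ _ _ => rfl
  have hGeq : G = mk F Fᵀ G + ((-(mk (N * C) Fᵀ) - mk F (N * C)ᵀ)
      (Sigmabar A C Lstar Sstar (L + (0 : ℝ) • N)) + (N * Sstar * Dᵀ + D * Sstar * Nᵀ)) := by
    refine aux_line (M := Matrix (Fin n) (Fin n) ℝ) (mk F Fᵀ) (-(mk (N * C) Fᵀ) - mk F (N * C)ᵀ) (mk (N * C) (N * C)ᵀ)
      (D * Sstar * Dᵀ) (N * Sstar * Dᵀ + D * Sstar * Nᵀ) (N * Sstar * Nᵀ)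
      (fun t : ℝ => Sigmabar A C Lstar Sstar (L + t • N)) G hg ?_
    have hc : Tendsto (fun t : ℝ => L + t • N) (𝓝 0) (𝓝 L) := by
      have := hline.continuousAt.tendsto
      rwa [hL0] at this
    filter_upwards [hc.eventually hev] with t ht
    refine ht.trans ?_
    have e1 : A - (L + t • N) * C = F - t • (N * C) := by
      rw [hF, Matrix.add_mul, Matrix.smul_mul]; abel
    have e2 : L + t • N - Lstar = D + t • N := by rw [hD]; abel
    rw [e1, e2]
    generalize Sigmabar A C Lstar Sstar (L + t • N) = Z
    simp only [LinearMap.sub_apply, LinearMap.neg_apply, hmk]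
    generalize N * C = K
    simp only [transpose_sub, transpose_add, transpose_smul, Matrix.sub_mul, Matrix.mul_sub,
      Matrix.add_mul, Matrix.mul_add, Matrix.smul_mul, Matrix.mul_smul, smul_sub, smul_add,
      smul_neg, smul_smul, Matrix.mul_assoc]
    abel
  rw [hL0, ← hP] at hGeq
  have hR : G = F * G * Fᵀ + (2 : ℝ) • (N * Nᵀ) := by
    refine hGeq.trans ?_
    have e3 : Nᵀ = Sstar * Dᵀ - C * (P * Fᵀ) := by
      rw [hN]
      simp [transpose_sub, transpose_mul, hSt, hsym]
    have e4 : (2 : ℝ) • (N * Nᵀ) = N * (Sstar * Dᵀ - C * (P * Fᵀ)) + (D * Sstar - F * P * Cᵀ) * Nᵀ := by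
      rw [← e3, ← hN, two_smul]
    rw [e4]
    simp only [LinearMap.sub_apply, LinearMap.neg_apply, hmk, Matrix.mul_sub, Matrix.sub_mul,
      Matrix.mul_assoc, transpose_mul]
    abel
  -- iterate
  have hit : ∀ k : ℕ, G = F ^ k * G * (F ^ k)ᵀ +
      ∑ i ∈ Finset.range k, (2 : ℝ) • ((F ^ i * N) * (F ^ i * N)ᵀ) := by
    intro k
    induction k with
    | zero => simp
    | succ k ih =>
      refine ih.trans ?_
      have e : F ^ k * G * (F ^ k)ᵀ = F ^ (k + 1) * G * (F ^ (k + 1))ᵀ +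
          (2 : ℝ) • ((F ^ k * N) * (F ^ k * N)ᵀ) := by
        calc F ^ k * G * (F ^ k)ᵀ
            = F ^ k * (F * G * Fᵀ + (2 : ℝ) • (N * Nᵀ)) * (F ^ k)ᵀ := by rw [← hR]
          _ = _ := by
            simp only [Matrix.mul_add, Matrix.add_mul, pow_succ, transpose_mul, Matrix.mul_assoc,
              Matrix.mul_smul, Matrix.smul_mul]
      rw [e, Finset.sum_range_succ]
      abel
  have hpos : ∀ i : ℕ, 0 ≤ auxPhi C W ((F ^ i * N) * (F ^ i * N)ᵀ) := fun i =>
    auxPhi_nonneg C W hW _ (by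
      simpa [conjTranspose_eq_transpose_of_trivial] using
        posSemidef_self_mul_conjTranspose (F ^ i * N))
  have hle : ∀ i k : ℕ, i < k → auxPhi C W ((F ^ i * N) * (F ^ i * N)ᵀ) ≤
      -auxPhi C W (F ^ k * G * (F ^ k)ᵀ) := by
    intro i k hik
    have e := congrArg (auxPhi C W) (hit k)
    rw [hphi, map_add, map_sum] at e
    have e' : auxPhi C W ((2 : ℝ) • ((F ^ i * N) * (F ^ i * N)ᵀ)) ≤
        ∑ i ∈ Finset.range k, auxPhi C W ((2 : ℝ) • ((F ^ i * N) * (F ^ i * N)ᵀ)) :=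
      Finset.single_le_sum (f := fun i => auxPhi C W ((2 : ℝ) • ((F ^ i * N) * (F ^ i * N)ᵀ)))
        (fun j _ => by
          have := hpos j
          rw [map_smul, smul_eq_mul]; positivity) (Finset.mem_range.2 hik)
    rw [map_smul, smul_eq_mul] at e'
    have := hpos i
    linarith
  have hlim : Tendsto (fun k : ℕ => -auxPhi C W (F ^ k * G * (F ^ k)ᵀ)) atTop (𝓝 0) := by
    have hc : Continuous (fun X : Matrix (Fin n) (Fin n) ℝ => -auxPhi C W (X * G * Xᵀ)) := by
      have h1 : Continuous (fun X : Matrix (Fin n) (Fin n) ℝ => X * G * Xᵀ) :=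
        (continuous_id.matrix_mul continuous_const).matrix_mul continuous_id.matrix_transpose
      exact ((auxPhi C W).continuous.comp h1).neg
    have := (hc.tendsto 0).comp h
    simpa [Function.comp_def] using this
  apply aux_obs A C L hObs
  intro i
  rw [← hF]
  apply auxPhi_zero C W hW
  refine le_antisymm (ge_of_tendsto hlim ?_) (hpos i)
  filter_upwards [eventually_gt_atTop i] with k hk
  exact hle i k hk

end

/-- **Unimodality of the limit.** If `(A, C)` is observable, `C` has full row rank,
`S*` and `W` are positive definite, `𝓛` is uniformly stabilizing and `L*` lies in the
interior of `𝓛`, then the unique stationary point of `V̄` in the closure of `𝓛` is `L*`. -/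
theorem unimodality_of_limit {n q : ℕ}
    (A : Matrix (Fin n) (Fin n) ℝ) (C : Matrix (Fin q) (Fin n) ℝ)
    (Lstar : Matrix (Fin n) (Fin q) ℝ) (Sstar W : Matrix (Fin q) (Fin q) ℝ)
    (hObs : (⋂ i : ℕ, {x : Fin n → ℝ | (C * A ^ i).mulVec x = 0}) = {0})
    (hC : C.rank = q)
    (hS : Sstar.PosDef) (hW : W.PosDef)
    (𝓛 : Set (Matrix (Fin n) (Fin q) ℝ))
    (γ lam : ℝ) (hγ : 0 < γ) (hlam : lam ∈ Set.Ioo (0 : ℝ) 1)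
    (hstab : ∀ L ∈ 𝓛, ∀ i : ℕ, opNorm ((A - L * C) ^ i) ≤ γ * lam ^ i)
    (hLstar : Lstar ∈ interior 𝓛) :
    ∀ L ∈ closure 𝓛,
      (fderiv ℝ (Vbar A C Lstar Sstar W) L = 0 ↔ L = Lstar) := by
  intro L hL
  have hlim : ∀ L ∈ closure 𝓛, Tendsto (fun i : ℕ => (A - L * C) ^ i) atTop (𝓝 0) := by
    intro L hL
    refine aux_pow_tendsto _ γ lam hlam fun i => ?_
    have hc : Continuous (fun L' : Matrix (Fin n) (Fin q) ℝ => opNorm ((A - L' * C) ^ i)) :=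
      aux_opNorm_continuous.comp
        ((continuous_const.sub (continuous_id.matrix_mul continuous_const)).pow i)
    exact closure_minimal (fun L' hL' => hstab L' hL' i) (isClosed_le hc continuous_const) hL
  have hstar := hlim Lstar (subset_closure (interior_subset hLstar))
  have hL' := hlim L hL
  have hSt : Sstarᵀ = Sstar := by
    simpa [Matrix.IsHermitian, conjTranspose_eq_transpose_of_trivial] using hS.isHermitian
  constructor
  · intro hd
    have hst := aux_stationary A C Lstar Sstar W L hObs hS hW hL' hd
    have hly := (aux_diff A C Lstar Sstar L hL').1.self_of_nhds
    have hDS : Sigmabar A C Lstar Sstar L = 0 → L = Lstar := by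
      intro h0
      rw [h0] at hst
      have h1 : (L - Lstar) * Sstar = 0 := by simpa using hst
      have h2 : IsUnit Sstar.det := (Matrix.isUnit_iff_isUnit_det _).1 hS.isUnit
      have h3 : (L - Lstar) * Sstar * Sstar⁻¹ = 0 := by rw [h1, Matrix.zero_mul]
      rw [Matrix.mul_nonsing_inv_cancel_right _ _ h2] at h3
      exact sub_eq_zero.1 h3
    apply hDS
    generalize Sigmabar A C Lstar Sstar L = P at hst hly
    have h1 : P = (A - L * C) * P * (A - Lstar * C)ᵀ := by
      have e : A - Lstar * C = (A - L * C) + (L - Lstar) * C := by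
        rw [Matrix.sub_mul]; abel
      rw [e, transpose_add, transpose_mul, Matrix.mul_add, ← Matrix.mul_assoc _ Cᵀ, ← hst,
        Matrix.mul_assoc _ P]
      exact hly
    have h2 : ∀ k : ℕ, P = (A - L * C) ^ k * P * ((A - Lstar * C) ^ k)ᵀ := by
      intro k
      induction k with
      | zero => simp
      | succ k ih =>
        calc P = (A - L * C) ^ k * P * ((A - Lstar * C) ^ k)ᵀ := ih
          _ = (A - L * C) ^ k * ((A - L * C) * P * (A - Lstar * C)ᵀ) * ((A - Lstar * C) ^ k)ᵀ := by
            rw [← h1]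
          _ = _ := by simp only [pow_succ, transpose_mul, Matrix.mul_assoc]
    have hc : Continuous (fun X : Matrix (Fin n) (Fin n) ℝ × Matrix (Fin n) (Fin n) ℝ =>
        X.1 * P * X.2ᵀ) :=
      (continuous_fst.matrix_mul continuous_const).matrix_mul continuous_snd.matrix_transpose
    have h3 := (hc.tendsto (0, 0)).comp (hL'.prodMk_nhds hstar)
    have h4 : Tendsto (fun _ : ℕ => P) atTop (𝓝 (0 * P * 0ᵀ)) := by
      refine h3.congr fun k => ?_
      exact (h2 k).symm
    simpa using tendsto_nhds_unique tendsto_const_nhds h4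
  · rintro rfl
    apply IsLocalMin.fderiv_eq_zero
    refine Eventually.of_forall fun L' => ?_
    rw [aux_Vbar, aux_Vbar]
    have h0 : Sigmabar A C L Sstar L = 0 := by simp [Sigmabar]
    rw [h0, map_zero]
    have := aux_phi_Sigmabar_nonneg A C L Sstar W L' hS hW
    linarith
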